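/- arXiv:1010.5160 — 2 statements merged into one kernel-verified Lean document; each statement's English description precedes it below -/
import Mathlib

section
/- Let X be a finite alphabet and Ψ = {S_j : X* → ℝ^p | j ∈ J} a family of formal power series. If R is a rational representation of Ψ with dim R ≤ N+1, then the span of the columns of the full Hankel matrix H_Ψ is finite-dimensional and its dimension equals rank H_{Ψ,N,N}. -/
open Matrix

section PowerSeriesDefs

variable {X J : Type*} {p n : ℕ}

/-- `A_w = A_{σ_k} ⋯ A_{σ_1}` for the word `w = σ_1 ⋯ σ_k`. -/
def wordProd {n : ℕ} (A : X → Matrix (Fin n) (Fin n) ℝ) : List X → Matrix (Fin n) (Fin n) ℝ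
  | [] => 1
  | σ :: w => wordProd A w * A σ

/-- Column of the full Hankel matrix of the family `S`, indexed by `(w, j)`. -/
def hankelCol (S : J → List X → Fin p → ℝ) (w : List X) (j : J) : List X × Fin p → ℝ :=
  fun vi => S j (w ++ vi.1) vi.2

/-- Linear span of the columns of the full Hankel matrix `H_Ψ`. -/
def fullHankelSpan (S : J → List X → Fin p → ℝ) : Submodule ℝ (List X × Fin p → ℝ) :=
  Submodule.span ℝ (Set.range fun wj : List X × J => hankelCol S wj.1 wj.2)

/-- Column of the sub-Hankel matrix `H_{Ψ,M,K}` (rows restricted to `|v| ≤ M`). -/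
def hankelColTrunc (S : J → List X → Fin p → ℝ) (M : ℕ) (w : List X) (j : J) :
    {v : List X // v.length ≤ M} × Fin p → ℝ :=
  fun vi => S j (w ++ vi.1.1) vi.2

/-- `rank H_{Ψ,M,K}` : dimension of the span of the columns of the sub-Hankel matrix
whose rows are indexed by `(v,i)` with `|v| ≤ M` and whose columns are indexed by
`(w,j)` with `|w| ≤ K`. -/
noncomputable def hankelRank (S : J → List X → Fin p → ℝ) (M K : ℕ) : ℕ :=
  Module.finrank ℝ (Submodule.span ℝ
    (Set.range fun wj : {w : List X // w.length ≤ K} × J =>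
      hankelColTrunc S M wj.1.1 wj.2))

/-- `R = (ℝⁿ, {A_σ}, B, C)` is an `N`-partial representation of the family `S`. -/
def IsPartialRep (S : J → List X → Fin p → ℝ) (N : ℕ)
    (A : X → Matrix (Fin n) (Fin n) ℝ) (B : J → Fin n → ℝ)
    (C : Matrix (Fin p) (Fin n) ℝ) : Prop :=
  ∀ (j : J) (w : List X), w.length ≤ N → S j w = C.mulVec ((wordProd A w).mulVec (B j))

/-- `R = (ℝⁿ, {A_σ}, B, C)` is a (complete) representation of the family `S`. -/
def IsRep (S : J → List X → Fin p → ℝ)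
    (A : X → Matrix (Fin n) (Fin n) ℝ) (B : J → Fin n → ℝ)
    (C : Matrix (Fin p) (Fin n) ℝ) : Prop :=
  ∀ (j : J) (w : List X), S j w = C.mulVec ((wordProd A w).mulVec (B j))

/-- Reachability: the span of the vectors `A_w B_j` is the whole state space. -/
def IsReachable (A : X → Matrix (Fin n) (Fin n) ℝ) (B : J → Fin n → ℝ) : Prop :=
  Submodule.span ℝ
    {x : Fin n → ℝ | ∃ (w : List X) (j : J), x = (wordProd A w).mulVec (B j)} = ⊤

/-- Observability: the intersection of the kernels of the maps `C A_w` is trivial. -/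
def IsObservable (A : X → Matrix (Fin n) (Fin n) ℝ)
    (C : Matrix (Fin p) (Fin n) ℝ) : Prop :=
  ∀ x : Fin n → ℝ, (∀ w : List X, C.mulVec ((wordProd A w).mulVec x) = 0) → x = 0

end PowerSeriesDefs

section HankelRank

variable {X J : Type*} {p n : ℕ}

theorem wordProd_append (A : X → Matrix (Fin n) (Fin n) ℝ) (w v : List X) :
    wordProd A (w ++ v) = wordProd A v * wordProd A w := by
  induction w with
  | nil => simp [wordProd]
  | cons σ w ih => simp [wordProd, ih, Matrix.mul_assoc]

/-- A monotone sequence of subspaces of an `n`-dimensional space that stays constant once two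
consecutive terms agree is constant from index `n` on. -/
theorem Submodule.eq_of_monotone_of_stable {K V : Type*} [Field K] [AddCommGroup V] [Module K V]
    [FiniteDimensional K V] {f : ℕ → Submodule K V} (hf : Monotone f)
    (hstab : ∀ k, f k = f (k + 1) → f (k + 1) = f (k + 2)) {k l : ℕ}
    (hk : Module.finrank K V ≤ k) (hkl : k ≤ l) : f k = f l := by
  have key : ∀ m, Module.finrank K V ≤ m →
      Module.finrank K (f m) = Module.finrank K (f (Module.finrank K V)) := fun m hm =>
    Nat.stabilises_of_monotone (f := fun m => Module.finrank K (f m))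
      (fun a b hab => Submodule.finrank_mono (hf hab)) (fun m => Submodule.finrank_le _)
      (fun m h => congrArg (fun W : Submodule K V => Module.finrank K W)
        (hstab m (Submodule.eq_of_le_of_finrank_eq (hf m.le_succ) h))) hm
  exact Submodule.eq_of_le_of_finrank_eq (hf hkl)
    ((key k hk).trans (key l (hk.trans hkl)).symm)

/-- An antitone sequence of subspaces of an `n`-dimensional space that stays constant once two
consecutive terms agree is constant from index `n` on. -/
theorem Submodule.eq_of_antitone_of_stable {K V : Type*} [Field K] [AddCommGroup V] [Module K V]
    [FiniteDimensional K V] {f : ℕ → Submodule K V} (hf : Antitone f)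
    (hstab : ∀ k, f k = f (k + 1) → f (k + 1) = f (k + 2)) {k l : ℕ}
    (hk : Module.finrank K V ≤ k) (hkl : k ≤ l) : f k = f l := by
  have h := Submodule.eq_of_monotone_of_stable (f := fun k => (f k).dualAnnihilator)
    (fun a b hab => Submodule.dualAnnihilator_anti (hf hab))
    (fun m h => congrArg Submodule.dualAnnihilator
      (hstab m (Subspace.dualAnnihilator_inj.mp h)))
    (Subspace.dual_finrank_eq.trans_le hk) hkl
  exact Subspace.dualAnnihilator_inj.mp h

/-- Span of the states `A_w B_j` reached by words of length `< k`. -/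
def reachSpan (A : X → Matrix (Fin n) (Fin n) ℝ) (B : J → Fin n → ℝ) (k : ℕ) :
    Submodule ℝ (Fin n → ℝ) :=
  Submodule.span ℝ {x | ∃ w : List X, ∃ j, w.length < k ∧ wordProd A w *ᵥ B j = x}

/-- States that are not distinguished from `0` by words of length `< k`. -/
def unobservable (A : X → Matrix (Fin n) (Fin n) ℝ) (C : Matrix (Fin p) (Fin n) ℝ) (k : ℕ) :
    Submodule ℝ (Fin n → ℝ) :=
  ⨅ (v : List X) (_ : v.length < k), LinearMap.ker (C * wordProd A v).mulVecLin

theorem mem_unobservable {A : X → Matrix (Fin n) (Fin n) ℝ} {C : Matrix (Fin p) (Fin n) ℝ}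
    {k : ℕ} {x : Fin n → ℝ} :
    x ∈ unobservable A C k ↔
      ∀ v : List X, v.length < k → C *ᵥ (wordProd A v *ᵥ x) = 0 := by
  simp [unobservable, Submodule.mem_iInf]

theorem mem_reachSpan (A : X → Matrix (Fin n) (Fin n) ℝ) (B : J → Fin n → ℝ) {k : ℕ}
    {w : List X} (hw : w.length < k) (j : J) : wordProd A w *ᵥ B j ∈ reachSpan A B k :=
  Submodule.subset_span ⟨w, j, hw, rfl⟩

theorem reachSpan_mono (A : X → Matrix (Fin n) (Fin n) ℝ) (B : J → Fin n → ℝ) :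
    Monotone (reachSpan A B) := fun _ _ hab =>
  Submodule.span_mono fun _ ⟨w, j, hw, h⟩ => ⟨w, j, hw.trans_le hab, h⟩

theorem mulVec_mem_reachSpan {A : X → Matrix (Fin n) (Fin n) ℝ} {B : J → Fin n → ℝ} {k : ℕ}
    {x : Fin n → ℝ} (hx : x ∈ reachSpan A B k) (σ : X) :
    A σ *ᵥ x ∈ reachSpan A B (k + 1) := by
  have h : reachSpan A B k ≤ (reachSpan A B (k + 1)).comap (A σ).mulVecLin := by
    refine Submodule.span_le.mpr ?_
    rintro _ ⟨w, j, hw, rfl⟩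
    have := mem_reachSpan A B (k := k + 1) (w := w ++ [σ]) (by simpa using hw) j
    simpa [wordProd_append, wordProd] using this
  exact h hx

theorem reachSpan_stable (A : X → Matrix (Fin n) (Fin n) ℝ) (B : J → Fin n → ℝ) (k : ℕ)
    (h : reachSpan A B k = reachSpan A B (k + 1)) :
    reachSpan A B (k + 1) = reachSpan A B (k + 2) := by
  refine le_antisymm (reachSpan_mono A B (Nat.le_succ _)) (Submodule.span_le.mpr ?_)
  rintro _ ⟨w, j, hw, rfl⟩
  rcases List.eq_nil_or_concat' w with rfl | ⟨u, σ, rfl⟩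
  · exact mem_reachSpan A B (by simp) j
  · have hu : wordProd A u *ᵥ B j ∈ reachSpan A B k :=
      h ▸ mem_reachSpan A B (by simpa using hw) j
    simpa [wordProd_append, wordProd] using mulVec_mem_reachSpan hu σ

theorem unobservable_anti (A : X → Matrix (Fin n) (Fin n) ℝ) (C : Matrix (Fin p) (Fin n) ℝ) :
    Antitone (unobservable A C) := fun _ _ hab _ hx =>
  mem_unobservable.mpr fun v hv => mem_unobservable.mp hx v (hv.trans_le hab)

theorem unobservable_stable (A : X → Matrix (Fin n) (Fin n) ℝ) (C : Matrix (Fin p) (Fin n) ℝ)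
    (k : ℕ) (h : unobservable A C k = unobservable A C (k + 1)) :
    unobservable A C (k + 1) = unobservable A C (k + 2) := by
  refine le_antisymm (fun x hx => mem_unobservable.mpr fun v hv => ?_)
    (unobservable_anti A C (Nat.le_succ _))
  have hx' := mem_unobservable.mp hx
  rcases v with _ | ⟨σ, v⟩
  · exact hx' [] (by simp)
  · have hσ : A σ *ᵥ x ∈ unobservable A C k := mem_unobservable.mpr fun u hu => by
      simpa [wordProd] using hx' (σ :: u) (by simpa using hu)
    rw [h, mem_unobservable] at hσ
    simpa [wordProd] using hσ v (by simpa using hv)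

/-- The map sending a state to its outputs along all words. -/
def observation (A : X → Matrix (Fin n) (Fin n) ℝ) (C : Matrix (Fin p) (Fin n) ℝ) :
    (Fin n → ℝ) →ₗ[ℝ] (List X × Fin p → ℝ) :=
  LinearMap.pi fun vi => LinearMap.proj vi.2 ∘ₗ (C * wordProd A vi.1).mulVecLin

theorem observation_apply (A : X → Matrix (Fin n) (Fin n) ℝ) (C : Matrix (Fin p) (Fin n) ℝ)
    (x : Fin n → ℝ) (vi : List X × Fin p) :
    observation A C x vi = (C *ᵥ (wordProd A vi.1 *ᵥ x)) vi.2 := by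
  simp [observation]

/-- Restriction of a Hankel column to the rows `(v, i)` with `|v| ≤ M`. -/
def truncateRows (X : Type*) (p M : ℕ) :
    (List X × Fin p → ℝ) →ₗ[ℝ] ({v : List X // v.length ≤ M} × Fin p → ℝ) :=
  LinearMap.funLeft ℝ ℝ fun vi => (vi.1.1, vi.2)

variable {S : J → List X → Fin p → ℝ} {A : X → Matrix (Fin n) (Fin n) ℝ} {B : J → Fin n → ℝ}
  {C : Matrix (Fin p) (Fin n) ℝ}

theorem IsRep.observation_eq_hankelCol (hrep : IsRep S A B C) (w : List X) (j : J) :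
    observation A C (wordProd A w *ᵥ B j) = hankelCol S w j := by
  funext vi
  simp [observation_apply, hankelCol, hrep j, wordProd_append]

theorem IsRep.map_reachSpan (hrep : IsRep S A B C) (k : ℕ) :
    (reachSpan A B k).map (observation A C) =
      Submodule.span ℝ {c | ∃ w : List X, ∃ j, w.length < k ∧ hankelCol S w j = c} := by
  rw [reachSpan, Submodule.map_span]
  congr 1
  ext c
  constructor
  · rintro ⟨_, ⟨w, j, hw, rfl⟩, rfl⟩
    exact ⟨w, j, hw, (hrep.observation_eq_hankelCol w j).symm⟩
  · rintro ⟨w, j, hw, rfl⟩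
    exact ⟨_, ⟨w, j, hw, rfl⟩, hrep.observation_eq_hankelCol w j⟩

theorem IsRep.fullHankelSpan_eq (hrep : IsRep S A B C) {k : ℕ} (hk : n ≤ k) :
    fullHankelSpan S = (reachSpan A B k).map (observation A C) := by
  refine le_antisymm (Submodule.span_le.mpr ?_) ?_
  · rintro _ ⟨⟨w, j⟩, rfl⟩
    refine ⟨wordProd A w *ᵥ B j, ?_, hrep.observation_eq_hankelCol w j⟩
    rw [SetLike.mem_coe, Submodule.eq_of_monotone_of_stable (reachSpan_mono A B)
      (reachSpan_stable A B) (by simpa using hk) (le_max_left k (w.length + 1))]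
    exact mem_reachSpan A B (by simp) j
  · rw [hrep.map_reachSpan]
    refine Submodule.span_mono ?_
    rintro _ ⟨w, j, -, rfl⟩
    exact ⟨(w, j), rfl⟩

theorem IsRep.truncHankelSpan_eq (hrep : IsRep S A B C) (M K : ℕ) :
    Submodule.span ℝ (Set.range fun wj : {w : List X // w.length ≤ K} × J =>
      hankelColTrunc S M wj.1.1 wj.2) =
    ((reachSpan A B (K + 1)).map (observation A C)).map (truncateRows X p M) := by
  rw [hrep.map_reachSpan, Submodule.map_span]
  congr 1
  ext c
  constructor
  · rintro ⟨⟨⟨w, hw⟩, j⟩, rfl⟩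
    exact ⟨_, ⟨w, j, Nat.lt_succ_of_le hw, rfl⟩, rfl⟩
  · rintro ⟨_, ⟨w, j, hw, rfl⟩, rfl⟩
    exact ⟨(⟨w, Nat.le_of_lt_succ hw⟩, j), rfl⟩

theorem observation_eq_zero_of_truncateRows {M : ℕ} (hM : n ≤ M + 1) {x : Fin n → ℝ}
    (hx : truncateRows X p M (observation A C x) = 0) : observation A C x = 0 := by
  have hmem : x ∈ unobservable A C (M + 1) := mem_unobservable.mpr fun v hv => by
    funext i
    have := congrFun hx (⟨v, Nat.le_of_lt_succ hv⟩, i)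
    exact (observation_apply A C x (v, i)).symm.trans this
  funext vi
  rw [Submodule.eq_of_antitone_of_stable (unobservable_anti A C) (unobservable_stable A C)
    (by simpa using hM) (le_max_left (M + 1) (vi.1.length + 1))] at hmem
  rw [observation_apply, mem_unobservable.mp hmem vi.1 (by simp)]
  rfl

end HankelRank

/-- if `Ψ` has a rational representation of dimension `n ≤ N+1`, then the
span of the columns of the full Hankel matrix `H_Ψ` is finite-dimensional and its
dimension equals `rank H_{Ψ,N,N}`. -/
theorem stmt2 {X J : Type*} [Fintype X] {p : ℕ} (S : J → List X → Fin p → ℝ)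
    (N n : ℕ) (hn : n ≤ N + 1)
    (A : X → Matrix (Fin n) (Fin n) ℝ) (B : J → Fin n → ℝ)
    (C : Matrix (Fin p) (Fin n) ℝ) (hrep : IsRep S A B C) :
    Module.rank ℝ (fullHankelSpan S) = (hankelRank S N N : Cardinal) := by
  have hfull := hrep.fullHankelSpan_eq hn
  have : FiniteDimensional ℝ (fullHankelSpan S) := by
    rw [hfull]
    infer_instance
  have hinj : Function.Injective ((truncateRows X p N).domRestrict (fullHankelSpan S)) := by
    rw [injective_iff_map_eq_zero]
    rintro ⟨c, hc⟩ h
    obtain ⟨x, -, rfl⟩ := hfull ▸ hc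
    exact Subtype.ext (observation_eq_zero_of_truncateRows hn h)
  rw [← Module.finrank_eq_rank, hankelRank, hrep.truncHankelSpan_eq, ← hfull,
    ← LinearMap.range_domRestrict, LinearMap.finrank_range_of_inj hinj]
end

section
/- Let X be a finite alphabet and Ψ = {S_j : X* → ℝ^p | j ∈ J} a family of formal power series, and suppose W_Ψ is finite-dimensional with dim W_Ψ ≤ N. Then for every T ∈ W_Ψ and every word w ∈ X*, the shifted series w∘T lies in the linear span of {v∘T : v ∈ X*, |v| ≤ N−1}. Consequently, if dim W_Ψ ≤ N+1, then W_Ψ equals the span of {w∘S_j : w ∈ X*, |w| ≤ N, j ∈ J}. -/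
section ShiftDefs

variable {X J : Type*} {p : ℕ}

/-- Left shift of a formal power series by the word `w` : `(w ∘ S)(v) = S(wv)`. -/
def wshift (w : List X) (T : List X → Fin p → ℝ) : List X → Fin p → ℝ :=
  fun v => T (w ++ v)

/-- `W_Ψ`: the smallest shift-invariant subspace containing the family `S`, i.e. the
linear span of all shifts `w ∘ S_j`. -/
def WPsi (S : J → List X → Fin p → ℝ) : Submodule ℝ (List X → Fin p → ℝ) :=
  Submodule.span ℝ (Set.range fun wj : List X × J => wshift wj.1 (S wj.2))

/-- `A_w = A_{σ_k} ∘ ⋯ ∘ A_{σ_1}` for a word `w = σ_1 ⋯ σ_k` and linear maps `A_σ`. -/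
def listComp {M : Type*} [AddCommMonoid M] [Module ℝ M]
    (A : X → M →ₗ[ℝ] M) : List X → M →ₗ[ℝ] M
  | [] => LinearMap.id
  | σ :: w => (listComp A w).comp (A σ)

end ShiftDefs

/-- The span of the shifts of the series in `E` by words of length less than `n`. -/
def shiftSpan {X : Type*} {p : ℕ} (E : Set (List X → Fin p → ℝ)) (n : ℕ) :
    Submodule ℝ (List X → Fin p → ℝ) :=
  Submodule.span ℝ {U | ∃ v : List X, ∃ T ∈ E, v.length < n ∧ U = wshift v T}

theorem wshift_wshift {X : Type*} {p : ℕ} (v w : List X) (T : List X → Fin p → ℝ) :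
    wshift w (wshift v T) = wshift (v ++ w) T := by
  funext u
  simp [wshift]

/-- The left shift by `w` as a linear map. -/
def wshiftLin {X : Type*} (p : ℕ) (w : List X) :
    (List X → Fin p → ℝ) →ₗ[ℝ] (List X → Fin p → ℝ) where
  toFun := wshift w
  map_add' _ _ := rfl
  map_smul' _ _ := rfl

section ShiftSpan

variable {X : Type*} {p : ℕ} {E : Set (List X → Fin p → ℝ)}

theorem wshift_mem_shiftSpan {n : ℕ} {v : List X} {T : List X → Fin p → ℝ} (hT : T ∈ E)
    (hv : v.length < n) : wshift v T ∈ shiftSpan E n :=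
  Submodule.subset_span ⟨v, T, hT, hv, rfl⟩

theorem shiftSpan_mono : Monotone (shiftSpan E) := fun _ _ h =>
  Submodule.span_mono fun _ ⟨v, T, hT, hv, hU⟩ => ⟨v, T, hT, hv.trans_le h, hU⟩

theorem wshift_singleton_mem_shiftSpan {n : ℕ} (σ : X) {U : List X → Fin p → ℝ}
    (hU : U ∈ shiftSpan E n) : wshift [σ] U ∈ shiftSpan E (n + 1) := by
  have h : shiftSpan E n ≤ (shiftSpan E (n + 1)).comap (wshiftLin p [σ]) := by
    refine Submodule.span_le.2 ?_
    rintro _ ⟨v, T, hT, hv, rfl⟩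
    change wshift [σ] (wshift v T) ∈ shiftSpan E (n + 1)
    rw [wshift_wshift]
    exact wshift_mem_shiftSpan hT (by simpa using hv)
  exact h hU

theorem wshift_mem_of_shiftSpan_eq_succ {n : ℕ} (h : shiftSpan E n = shiftSpan E (n + 1))
    {T : List X → Fin p → ℝ} (hT : T ∈ E) (w : List X) : wshift w T ∈ shiftSpan E n := by
  induction w using List.reverseRecOn with
  | nil => rw [h]; exact wshift_mem_shiftSpan hT (by simp)
  | append_singleton w σ ih =>
    rw [← wshift_wshift, h]
    exact wshift_singleton_mem_shiftSpan σ ih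

/-- The spans `shiftSpan E n` grow strictly until they contain all shifts. -/
theorem le_finrank_shiftSpan_or {W : Submodule ℝ (List X → Fin p → ℝ)} [FiniteDimensional ℝ W]
    (hW : ∀ n, shiftSpan E n ≤ W) (n : ℕ) :
    n ≤ Module.finrank ℝ (shiftSpan E n) ∨
      ∀ T ∈ E, ∀ w : List X, wshift w T ∈ shiftSpan E n := by
  induction n with
  | zero => exact Or.inl (Nat.zero_le _)
  | succ n ih =>
    have hmono : shiftSpan E n ≤ shiftSpan E (n + 1) := shiftSpan_mono n.le_succ
    rcases ih with ih | ih
    · rcases hmono.eq_or_lt with h | h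
      · exact Or.inr fun T hT w => hmono (wshift_mem_of_shiftSpan_eq_succ h hT w)
      · have : FiniteDimensional ℝ (shiftSpan E (n + 1)) :=
          Submodule.finiteDimensional_of_le (hW (n + 1))
        exact Or.inl (ih.trans_lt (Submodule.finrank_lt_finrank_of_lt h))
    · exact Or.inr fun T hT w => hmono (ih T hT w)

/-- If all shifts of the series in `E` lie in a space of dimension at most `N`, then they are
spanned by the shifts by words of length less than `N`. -/
theorem wshift_mem_shiftSpan_of_rank_le {W : Submodule ℝ (List X → Fin p → ℝ)} {N : ℕ}
    (hN : Module.rank ℝ W ≤ (N : Cardinal)) (hW : ∀ T ∈ E, ∀ w : List X, wshift w T ∈ W)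
    {T : List X → Fin p → ℝ} (hT : T ∈ E) (w : List X) : wshift w T ∈ shiftSpan E N := by
  have : FiniteDimensional ℝ W :=
    Module.rank_lt_aleph0_iff.1 (hN.trans_lt Cardinal.natCast_lt_aleph0)
  have hle : ∀ n, shiftSpan E n ≤ W := by
    intro n
    refine Submodule.span_le.2 ?_
    rintro _ ⟨v, T, hT, -, rfl⟩
    exact hW T hT v
  rcases le_finrank_shiftSpan_or hle N with h | h
  · rw [Submodule.eq_of_le_of_finrank_le (hle N) ((Module.finrank_le_of_rank_le hN).trans h)]
    exact hW T hT w
  · exact h T hT w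

end ShiftSpan

theorem wshift_mem_WPsi {X J : Type*} {p : ℕ} {S : J → List X → Fin p → ℝ}
    {T : List X → Fin p → ℝ} (hT : T ∈ WPsi S) (w : List X) : wshift w T ∈ WPsi S := by
  have h : WPsi S ≤ (WPsi S).comap (wshiftLin p w) := by
    refine Submodule.span_le.2 ?_
    rintro _ ⟨⟨v, j⟩, rfl⟩
    exact Submodule.subset_span ⟨(v ++ w, j), (wshift_wshift v w (S j)).symm⟩
  exact h hT

/-- if `dim W_Ψ ≤ N`, then for every `T ∈ W_Ψ` and every word `w`, the
shift `w ∘ T` lies in the span of the shifts `v ∘ T` with `|v| ≤ N-1` (i.e. `|v| < N`);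
consequently, if `dim W_Ψ ≤ N+1`, then `W_Ψ` equals the span of the shifts
`w ∘ S_j` with `|w| ≤ N`. -/
theorem stmt14 {X J : Type*} [Fintype X] {p : ℕ} (S : J → List X → Fin p → ℝ)
    (N : ℕ) :
    (Module.rank ℝ (WPsi S) ≤ (N : Cardinal) →
      ∀ T ∈ WPsi S, ∀ w : List X,
        wshift w T ∈ Submodule.span ℝ
          {U : List X → Fin p → ℝ | ∃ v : List X, v.length < N ∧ U = wshift v T}) ∧
    (Module.rank ℝ (WPsi S) ≤ ((N : Cardinal) + 1) →
      WPsi S = Submodule.span ℝ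
        {U : List X → Fin p → ℝ |
          ∃ (w : List X) (j : J), w.length ≤ N ∧ U = wshift w (S j)}) := by
  refine ⟨fun hN T hT w => ?_, fun hN => le_antisymm ?_ ?_⟩
  · have h := wshift_mem_shiftSpan_of_rank_le (E := {T}) hN
      (by rintro _ rfl v; exact wshift_mem_WPsi hT v) rfl w
    simpa [shiftSpan] using h
  · refine Submodule.span_le.2 ?_
    rintro _ ⟨⟨w, j⟩, rfl⟩
    have h := wshift_mem_shiftSpan_of_rank_le (E := Set.range S) (N := N + 1)
      (by exact_mod_cast hN)
      (by rintro _ ⟨i, rfl⟩ v; exact Submodule.subset_span ⟨(v, i), rfl⟩) ⟨j, rfl⟩ w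
    simpa [shiftSpan, Nat.lt_succ_iff] using h
  · refine Submodule.span_le.2 ?_
    rintro _ ⟨w, j, -, rfl⟩
    exact Submodule.subset_span ⟨(w, j), rfl⟩
end
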